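/- arXiv:2310.00467 — 2 statements merged into one kernel-verified Lean document; each statement's English description precedes it below -/
import Mathlib

section
/- If m = ⌈k/t⌉ + r and n ≥ tm, then the minimum total storage N(n,m,k,t,r) over all ECBC(n,m,k,t,r) systems equals tm(r+1) + m(n − tm); that is, an ECBC(n,m,k,t,r) with this total storage exists, and no ECBC(n,m,k,t,r) has smaller total storage. -/
/-- An `m × n` storage system `S` (server `i` stores the files in `S i`) is an
`ECBC(n,m,k,t,r)` if for every subset `X'` of files with `|X'| ≤ k` and every set `J` of
servers with `|J| ≥ m − r`, there exist sets `C j ⊆ S j` for `j ∈ J` with `|C j| ≤ t`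
whose union is `X'`. -/
def isECBC (n m k t r : ℕ) (S : Fin m → Finset (Fin n)) : Prop :=
  ∀ X' : Finset (Fin n), X'.card ≤ k →
    ∀ J : Finset (Fin m), m - r ≤ J.card →
      ∃ C : Fin m → Finset (Fin n),
        (∀ j ∈ J, C j ⊆ S j ∧ (C j).card ≤ t) ∧ J.biUnion C = X'

open Finset

/-- Hall's theorem with capacities: if every `W ⊆ X` has at least `#W / t` neighbours in `J`, then
`X` can be split among the members of `J` so that each one receives at most `t` neighbours. -/
theorem exists_bounded_cover_of_hall {α β : Type*} [DecidableEq α] [DecidableEq β]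
    (X : Finset α) (J : Finset β) (R : α → Finset β) (t : ℕ)
    (h : ∀ W ⊆ X, #W ≤ t * #(W.biUnion R ∩ J)) :
    ∃ C : β → Finset α, (∀ j, (∀ x ∈ C j, j ∈ R x) ∧ #(C j) ≤ t) ∧ J.biUnion C = X := by
  obtain ⟨φ, hφ, hmem⟩ := (Finset.all_card_le_biUnion_card_iff_exists_injective
    (fun x : X => (R x ∩ J) ×ˢ (univ : Finset (Fin t)))).1 (by
      intro W
      have hW := h (W.map (Function.Embedding.subtype _)) (by
        intro x hx
        simp only [Finset.mem_map, Function.Embedding.subtype_apply] at hx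
        obtain ⟨y, -, rfl⟩ := hx
        exact y.2)
      rw [Finset.card_map] at hW
      refine hW.trans ?_
      rw [mul_comm]
      have := Finset.card_product (((W.map (Function.Embedding.subtype _)).biUnion R) ∩ J)
        (univ : Finset (Fin t))
      rw [Finset.card_fin] at this
      rw [← this]
      apply Finset.card_le_card
      rintro ⟨b, i⟩ hb
      simp only [mem_product, mem_inter, mem_biUnion, Finset.mem_map,
        Function.Embedding.subtype_apply, mem_univ, and_true] at hb ⊢
      obtain ⟨⟨_, ⟨y, hy, rfl⟩, hb⟩, hJ⟩ := hb
      exact ⟨y, hy, hb, hJ⟩)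
  simp only [mem_product, mem_inter, mem_univ, and_true] at hmem
  refine ⟨fun j => ({x | (φ x).1 = j} : Finset X).map (Function.Embedding.subtype _),
    fun j => ⟨?_, ?_⟩, ?_⟩
  · intro x hx
    simp only [Finset.mem_map, mem_filter, mem_univ, true_and,
      Function.Embedding.subtype_apply] at hx
    obtain ⟨y, rfl, rfl⟩ := hx
    exact (hmem y).1
  · rw [Finset.card_map]
    calc _ ≤ #(univ : Finset (Fin t)) := by
          refine Finset.card_le_card_of_injOn (fun x => (φ x).2) (fun _ _ => mem_univ _) ?_
          intro x hx y hy hxy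
          simp only [coe_filter, mem_univ, true_and, Set.mem_ofPred_eq] at hx hy
          exact hφ (Prod.ext (hx.trans hy.symm) hxy)
      _ = t := Finset.card_fin t
  · ext x
    simp only [mem_biUnion, Finset.mem_map, mem_filter, mem_univ, true_and,
      Function.Embedding.subtype_apply]
    constructor
    · rintro ⟨_, _, y, _, rfl⟩
      exact y.2
    · intro hx
      exact ⟨_, (hmem ⟨x, hx⟩).2, ⟨x, hx⟩, rfl, rfl⟩

/-- The cyclic shift of `b : Fin m` by `s`. -/
def cyclicShift {m : ℕ} (s : ℕ) (b : Fin m) : Fin m := ⟨(b + s) % m, Nat.mod_lt _ b.pos⟩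

/-- The cyclic interval `{b, b + 1, …, b + r}` in `Fin m`. -/
def cyclicInterval {m : ℕ} (r : ℕ) (b : Fin m) : Finset (Fin m) :=
  (range (r + 1)).image fun s => cyclicShift s b

theorem cyclicShift_cyclicShift {m : ℕ} (s s' : ℕ) (b : Fin m) :
    cyclicShift s' (cyclicShift s b) = cyclicShift (s + s') b := by
  ext
  simp [cyclicShift, add_assoc]

theorem eq_univ_of_cyclicShift_mem {m : ℕ} {A : Finset (Fin m)} (hA : A.Nonempty)
    (h : ∀ a ∈ A, cyclicShift 1 a ∈ A) : A = univ := by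
  obtain ⟨a, ha⟩ := hA
  have hs : ∀ s, cyclicShift s a ∈ A := by
    intro s
    induction s with
    | zero => simpa [cyclicShift, Nat.mod_eq_of_lt a.2] using ha
    | succ s ih => simpa [cyclicShift_cyclicShift] using h _ ih
  refine Finset.eq_univ_of_forall fun j => ?_
  convert hs (m - a + j)
  ext
  have h₁ : (a : ℕ) + (m - a + j) = j + m := by omega
  simp [cyclicShift, h₁, Nat.mod_eq_of_lt j.2]

/-- A cyclic Cauchy–Davenport bound: a union of cyclic intervals of length `r + 1` with starting
points `B` is everything or has at least `#B + r` elements. -/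
theorem biUnion_cyclicInterval_eq_univ_or_card_le {m : ℕ} {B : Finset (Fin m)}
    (hB : B.Nonempty) (r : ℕ) :
    B.biUnion (cyclicInterval r) = univ ∨ #B + r ≤ #(B.biUnion (cyclicInterval r)) := by
  have hsub : ∀ r, B ⊆ B.biUnion (cyclicInterval r) := fun r b hb =>
    mem_biUnion.2 ⟨b, hb, mem_image.2 ⟨0, by simp, by
      ext; simp [cyclicShift, Nat.mod_eq_of_lt b.2]⟩⟩
  induction r with
  | zero => exact Or.inr (Finset.card_le_card (hsub 0))
  | succ r ih =>
    have hmono : B.biUnion (cyclicInterval r) ⊆ B.biUnion (cyclicInterval (r + 1)) :=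
      Finset.biUnion_mono fun b _ => Finset.image_subset_image
        (Finset.range_subset_range.2 (Nat.le_succ _))
    rcases ih with ih | ih
    · exact Or.inl (Finset.univ_subset_iff.1 (ih ▸ hmono))
    · rcases hmono.eq_or_ssubset with heq | hlt
      · refine Or.inl (heq ▸ eq_univ_of_cyclicShift_mem (hB.mono (hsub r)) ?_)
        intro a ha
        rw [heq]
        simp only [mem_biUnion, cyclicInterval, mem_image, mem_range] at ha ⊢
        obtain ⟨b, hb, s, hs, rfl⟩ := ha
        exact ⟨b, hb, s + 1, by omega, (cyclicShift_cyclicShift _ _ _).symm⟩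
      · have := Finset.card_lt_card hlt
        exact Or.inr (by omega)

/-- The servers holding file `f`: a cyclic interval of `r + 1` servers for the first `t * m` files
and all servers for the others. -/
def holders {m : ℕ} (hm : 0 < m) (t r f : ℕ) : Finset (Fin m) :=
  if f < t * m then cyclicInterval r ⟨f % m, Nat.mod_lt _ hm⟩ else univ

theorem biUnion_holders_eq_univ_or_card_le {n m t r : ℕ} (hm : 0 < m) {W : Finset (Fin n)}
    (hW : W.Nonempty) :
    W.biUnion (fun f => holders hm t r f) = univ ∨
      #W ≤ t * (#(W.biUnion fun f => holders hm t r f) - r) := by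
  by_cases hall : ∀ f ∈ W, (f : ℕ) < t * m
  · have hU : W.biUnion (fun f => holders hm t r f) =
        (W.image fun f : Fin n => (⟨f % m, Nat.mod_lt _ hm⟩ : Fin m)).biUnion
          (cyclicInterval r) := by
      rw [Finset.image_biUnion]
      exact Finset.biUnion_congr rfl fun f hf => by simp [holders, hall f hf]
    rw [hU]
    refine (biUnion_cyclicInterval_eq_univ_or_card_le (hW.image _) r).imp id fun hcard => ?_
    have hfib := Finset.card_le_mul_card_image
      (f := fun f : Fin n => (⟨f % m, Nat.mod_lt _ hm⟩ : Fin m)) W t (by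
        intro b _
        refine (Finset.card_le_card_of_injOn (t := range t) (fun f : Fin n => (f : ℕ) / m)
          ?_ ?_).trans_eq (Finset.card_range t)
        · intro f hf
          simp only [coe_filter, Set.mem_ofPred_eq] at hf
          simpa using (Nat.div_lt_iff_lt_mul hm).2 (hall f hf.1)
        · intro f hf g hg hfg
          simp only [coe_filter, Set.mem_ofPred_eq, Fin.ext_iff] at hf hg
          ext
          rw [← Nat.div_add_mod f m, ← Nat.div_add_mod g m, hf.2, hg.2]
          simp only at hfg
          rw [hfg])
    exact hfib.trans (Nat.mul_le_mul_left t (by omega))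
  · push Not at hall
    obtain ⟨f, hf, hlt⟩ := hall
    refine Or.inl (Finset.univ_subset_iff.1 fun j _ => mem_biUnion.2 ⟨f, hf, ?_⟩)
    simp [holders, not_lt.2 hlt]

theorem isECBC_filter_mem_holders {n m k t r : ℕ} (hm : 0 < m) (hk : k ≤ t * (m - r)) :
    isECBC n m k t r fun j => ({f | j ∈ holders hm t r f} : Finset (Fin n)) := by
  intro X hX J hJ
  obtain ⟨C, hC, hU⟩ := exists_bounded_cover_of_hall X J (fun f => holders hm t r f) t (by
    intro W hWX
    rcases W.eq_empty_or_nonempty with rfl | hW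
    · simp
    rcases biUnion_holders_eq_univ_or_card_le (t := t) (r := r) hm hW with h | h
    · rw [h, univ_inter]
      exact ((Finset.card_le_card hWX).trans (hX.trans hk)).trans (Nat.mul_le_mul_left t hJ)
    · refine h.trans (Nat.mul_le_mul_left t ?_)
      have h₁ := Finset.card_union_add_card_inter (W.biUnion fun f => holders hm t r f) J
      have h₂ := Finset.card_le_univ ((W.biUnion fun f => holders hm t r f) ∪ J)
      rw [Fintype.card_fin] at h₂
      omega)
  exact ⟨C, fun j _ => ⟨fun f hf => by simpa using (hC j).1 f hf, (hC j).2⟩, hU⟩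

theorem sum_card_filter_mem_holders_le {n m t r : ℕ} (hm : 0 < m) (hn : t * m ≤ n) :
    ∑ j : Fin m, #({f | j ∈ holders hm t r f} : Finset (Fin n)) ≤
      t * m * (r + 1) + m * (n - t * m) := by
  have hswap := Finset.sum_card_bipartiteAbove_eq_sum_card_bipartiteBelow
    (s := (univ : Finset (Fin m))) (t := (univ : Finset (Fin n)))
    (fun j (f : Fin n) => j ∈ holders hm t r f)
  simp only [bipartiteAbove, bipartiteBelow, filter_univ_mem] at hswap
  rw [hswap, Fin.sum_univ_eq_sum_range (fun f => #(holders hm t r f)) n,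
    ← Finset.sum_range_add_sum_Ico _ hn]
  gcongr
  · refine (Finset.sum_le_card_nsmul _ _ (r + 1) fun f hf => ?_).trans_eq (by simp)
    rw [holders, if_pos (mem_range.1 hf)]
    exact Finset.card_image_le.trans_eq (Finset.card_range _)
  · refine (Finset.sum_le_card_nsmul _ _ m fun f _ => ?_).trans_eq (by simp [mul_comm])
    exact (Finset.card_le_univ _).trans_eq (Fintype.card_fin m)

/-- In an ECBC, every server misses at most `t * (m - r - 1)` files. -/
theorem isECBC.card_compl_le {n m k t r : ℕ} {S : Fin m → Finset (Fin n)}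
    (hS : isECBC n m k t r S) (hr : r < m) (hk : t * (m - r - 1) < k) (j : Fin m) :
    #(S j)ᶜ ≤ t * (m - r - 1) := by
  by_contra! hlt
  obtain ⟨X, hXS, hX⟩ := Finset.exists_subset_card_eq (Nat.succ_le_of_lt hlt)
  obtain ⟨J, hjJ, -, hJ⟩ := Finset.exists_subsuperset_card_eq (n := m - r)
    (Finset.subset_univ {j}) (by simp; omega) (by simp)
  obtain ⟨C, hC, hU⟩ := hS X (by omega) J hJ.ge
  have hj : j ∈ J := hjJ (mem_singleton_self j)
  have hCj : C j = ∅ := Finset.eq_empty_of_forall_notMem fun f hf =>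
    mem_compl.1 (hXS (hU ▸ mem_biUnion.2 ⟨j, hj, hf⟩)) ((hC j hj).1 hf)
  have hcov : X = (J.erase j).biUnion C := by
    conv_lhs => rw [← hU, ← Finset.insert_erase hj, Finset.biUnion_insert, hCj, empty_union]
  have hle : #X ≤ #(J.erase j) * t := by
    rw [hcov]
    exact Finset.card_biUnion_le_card_mul _ _ _ fun i hi => (hC i (mem_of_mem_erase hi)).2
  rw [Finset.card_erase_of_mem hj, hJ, mul_comm] at hle
  omega

theorem isECBC.le_sum_card {n m k t r : ℕ} {S : Fin m → Finset (Fin n)}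
    (hS : isECBC n m k t r S) (hr : r < m) (hk : t * (m - r - 1) < k) (hn : t * m ≤ n) :
    t * m * (r + 1) + m * (n - t * m) ≤ ∑ i, #(S i) := by
  have hcard : ∀ j ∈ (univ : Finset (Fin m)), t * (r + 1) + (n - t * m) ≤ #(S j) := by
    intro j _
    have h₁ := hS.card_compl_le hr hk j
    have h₂ := Finset.card_add_card_compl (S j)
    rw [Fintype.card_fin] at h₂
    have h₃ : t * (r + 1) + t * (m - r - 1) = t * m := by
      rw [← Nat.mul_add]
      congr 1
      omega
    omega
  refine le_trans (le_of_eq ?_) (Finset.card_nsmul_le_sum _ _ _ hcard)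
  simp only [card_univ, Fintype.card_fin, smul_eq_mul]
  ring

/-- If `m = ⌈k/t⌉ + r` and `n ≥ t·m`, the minimum total storage over all
`ECBC(n,m,k,t,r)` systems equals `t·m·(r+1) + m·(n − t·m)`. -/
theorem ecbc_min_storage_small_m (n m k t r : ℕ)
    (hn : 1 ≤ n) (hm' : 1 ≤ m) (hk : 1 ≤ k) (ht : 1 ≤ t) (hkn : k ≤ n)
    (hm : m = (k + t - 1) / t + r) (hntm : t * m ≤ n) :
    (∃ S : Fin m → Finset (Fin n), isECBC n m k t r S ∧
        ∑ i, (S i).card = t * m * (r + 1) + m * (n - t * m)) ∧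
    (∀ S : Fin m → Finset (Fin n), isECBC n m k t r S →
        t * m * (r + 1) + m * (n - t * m) ≤ ∑ i, (S i).card) := by
  have hq : m - r = (k + t - 1) / t := by rw [hm, Nat.add_sub_cancel]
  have hdiv := Nat.div_add_mod (k + t - 1) t
  have hmod := Nat.mod_lt (k + t - 1) ht
  have hq1 : 1 ≤ (k + t - 1) / t := (Nat.one_le_div_iff ht).2 (by omega)
  have hupper : k ≤ t * (m - r) := by rw [hq]; omega
  have hlower : t * (m - r - 1) < k := by
    rw [hq, Nat.mul_sub, mul_one]
    omega
  have hlb := fun (S : Fin m → Finset (Fin n)) (hS : isECBC n m k t r S) =>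
    hS.le_sum_card (by omega) hlower hntm
  have hS := isECBC_filter_mem_holders (n := n) hm' hupper
  exact ⟨⟨_, hS, le_antisymm (sum_card_filter_mem_holders_le hm' hntm) (hlb _ hS)⟩, hlb⟩
end

section
/- If n ≥ k and m ≥ ⌈k/t⌉ + r, then the minimum total storage over all consecutive ECBC(n,m,k,t,r) systems equals (r+1)n; that is, a consecutive ECBC(n,m,k,t,r) with total storage (r+1)n exists, and every consecutive ECBC(n,m,k,t,r) has total storage at least (r+1)n. -/
/-- An `m × n` storage system `S` is a consecutive `ECBC(n,m,k,t,r)` if for every set of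
at most `k` files with consecutive indices `{a, a+1, …, b}` and every set `J` of servers
with `|J| ≥ m − r`, there exist sets `C j ⊆ S j` for `j ∈ J` with `|C j| ≤ t` whose union
is `{a, a+1, …, b}`. -/
def isConsecutiveECBC (n m k t r : ℕ) (S : Fin m → Finset (Fin n)) : Prop :=
  ∀ a b : Fin n, a ≤ b → (b : ℕ) - (a : ℕ) + 1 ≤ k →
    ∀ J : Finset (Fin m), m - r ≤ J.card →
      ∃ C : Fin m → Finset (Fin n),
        (∀ j ∈ J, C j ⊆ S j ∧ (C j).card ≤ t) ∧ J.biUnion C = Finset.Icc a b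

/-- The residues modulo `m` of all sums `x + i` with `x ∈ Y` and `i ≤ r`. -/
def cyclicThickening (m r : ℕ) (Y : Finset ℕ) : Finset ℕ :=
  (Y ×ˢ Finset.range (r + 1)).image fun p => (p.1 + p.2) % m

theorem mem_cyclicThickening {m r : ℕ} {Y : Finset ℕ} {z : ℕ} :
    z ∈ cyclicThickening m r Y ↔ ∃ x ∈ Y, ∃ i ≤ r, (x + i) % m = z := by
  simp only [cyclicThickening, Finset.mem_image, Finset.mem_product, Finset.mem_range,
    Prod.exists, Nat.lt_succ_iff]
  constructor
  · rintro ⟨x, i, ⟨hx, hi⟩, h⟩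
    exact ⟨x, hx, i, hi, h⟩
  · rintro ⟨x, hx, i, hi, h⟩
    exact ⟨x, i, ⟨hx, hi⟩, h⟩

theorem cyclicThickening_subset_range {m : ℕ} (hm : 0 < m) (r : ℕ) (Y : Finset ℕ) :
    cyclicThickening m r Y ⊆ Finset.range m := by
  intro z hz
  obtain ⟨x, -, i, -, rfl⟩ := mem_cyclicThickening.1 hz
  exact Finset.mem_range.2 (Nat.mod_lt _ hm)

/-- A nonempty set of residues closed under the cyclic successor contains every residue. -/
theorem range_subset_of_closed_succ_mod {m : ℕ} {A : Finset ℕ} (hA : A.Nonempty)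
    (hAm : A ⊆ Finset.range m) (hsucc : ∀ z ∈ A, (z + 1) % m ∈ A) : Finset.range m ⊆ A := by
  obtain ⟨z, hz⟩ := hA
  have hadd : ∀ i : ℕ, (z + i) % m ∈ A := by
    intro i
    induction i with
    | zero => rwa [Nat.add_zero, Nat.mod_eq_of_lt (Finset.mem_range.1 (hAm hz))]
    | succ i ih => simpa [Nat.add_assoc] using hsucc _ ih
  intro w hw
  have hwm := Finset.mem_range.1 hw
  have hzm := Finset.mem_range.1 (hAm hz)
  have h := hadd (m - z + w)
  rwa [show z + (m - z + w) = w + m by omega, Nat.add_mod_right, Nat.mod_eq_of_lt hwm] at h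

/-- A Cauchy–Davenport bound for adding a cyclic interval to a set of residues. -/
theorem min_le_card_cyclicThickening {m : ℕ} (hm : 0 < m) (r : ℕ) {Y : Finset ℕ}
    (hY : Y.Nonempty) :
    min m ((Y.image (· % m)).card + r) ≤ (cyclicThickening m r Y).card := by
  induction r with
  | zero =>
    refine (min_le_right _ _).trans (Finset.card_le_card fun z hz => ?_)
    obtain ⟨x, hx, rfl⟩ := Finset.mem_image.1 hz
    exact mem_cyclicThickening.2 ⟨x, hx, 0, le_rfl, rfl⟩
  | succ r ih =>
    have hsub : cyclicThickening m r Y ⊆ cyclicThickening m (r + 1) Y := by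
      intro z hz
      obtain ⟨x, hx, i, hi, h⟩ := mem_cyclicThickening.1 hz
      exact mem_cyclicThickening.2 ⟨x, hx, i, hi.trans r.le_succ, h⟩
    rcases (Finset.card_le_card hsub).lt_or_eq with hlt | heq
    · omega
    · have hself := Finset.eq_of_subset_of_card_le hsub heq.ge
      have hne : (cyclicThickening m r Y).Nonempty := by
        obtain ⟨x, hx⟩ := hY
        exact ⟨_, mem_cyclicThickening.2 ⟨x, hx, 0, Nat.zero_le _, rfl⟩⟩
      have hall : Finset.range m ⊆ cyclicThickening m r Y := by
        refine range_subset_of_closed_succ_mod hne (cyclicThickening_subset_range hm r Y) ?_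
        intro z hz
        obtain ⟨x, hx, i, hi, rfl⟩ := mem_cyclicThickening.1 hz
        rw [hself]
        exact mem_cyclicThickening.2
          ⟨x, hx, i + 1, Nat.succ_le_succ hi, by simp [← Nat.add_assoc]⟩
      have hcard := Finset.card_le_card (hall.trans hsub)
      rw [Finset.card_range] at hcard
      exact (min_le_left _ _).trans hcard

/-- A set of naturals inside a window of length `t * m` has at most `t` elements in each residue
class modulo `m`. -/
theorem card_le_mul_card_image_mod {m t a : ℕ} {Y : Finset ℕ}
    (hY : ∀ x ∈ Y, a ≤ x ∧ x < a + t * m) :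
    Y.card ≤ t * (Y.image (· % m)).card := by
  refine Finset.card_le_mul_card_image Y t fun c _ => ?_
  rw [← Finset.card_range t]
  refine Finset.card_le_card_of_injOn (fun x => (x - a) / m) ?_ ?_
  · intro x hx
    obtain ⟨hxY, -⟩ := Finset.mem_filter.1 hx
    have h := hY x hxY
    exact Finset.mem_coe.2 (Finset.mem_range.2 (Nat.div_lt_of_lt_mul (by rw [mul_comm]; omega)))
  · intro x hx y hy hxy
    obtain ⟨hxY, hxc⟩ := Finset.mem_filter.1 hx
    obtain ⟨hyY, hyc⟩ := Finset.mem_filter.1 hy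
    obtain ⟨u, rfl⟩ := Nat.exists_eq_add_of_le (hY x hxY).1
    obtain ⟨v, rfl⟩ := Nat.exists_eq_add_of_le (hY y hyY).1
    have hmod : u % m = v % m := Nat.ModEq.add_left_cancel' a (hxc.trans hyc.symm)
    simp only [Nat.add_sub_cancel_left] at hxy
    rw [← Nat.div_add_mod u m, ← Nat.div_add_mod v m, hxy, hmod]

/-- Hall's theorem where every element of `β` may be used up to `t` times. -/
theorem exists_cover_of_card_le_mul_card_biUnion {α β : Type*} [DecidableEq α] [DecidableEq β]
    (X : Finset α) (N : α → Finset β) (t : ℕ)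
    (hall : ∀ Y ⊆ X, Y.card ≤ t * (Y.biUnion N).card) :
    ∃ C : β → Finset α, (∀ j, (C j).card ≤ t) ∧ (∀ j, ∀ x ∈ C j, x ∈ X ∧ j ∈ N x) ∧
      ∀ x ∈ X, ∃ j ∈ N x, x ∈ C j := by
  obtain ⟨f, hf, hfN⟩ := (Finset.all_card_le_biUnion_card_iff_exists_injective
    fun x : X => N x ×ˢ (Finset.univ : Finset (Fin t))).1 fun s => by
      have h := hall (s.map (Function.Embedding.subtype _)) fun x hx => by
        obtain ⟨y, -, rfl⟩ := Finset.mem_map.1 hx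
        exact y.2
      have heq : (s.biUnion fun x : X => N x ×ˢ (Finset.univ : Finset (Fin t))) =
          (s.map (Function.Embedding.subtype _)).biUnion N ×ˢ Finset.univ := by
        ext ⟨j, i⟩
        simp
      rw [heq, Finset.card_product, Finset.card_univ, Fintype.card_fin, mul_comm]
      simpa using h
  refine ⟨fun j => (Finset.univ.filter fun x : X => (f x).1 = j).map
    (Function.Embedding.subtype _), fun j => ?_, fun j x hx => ?_, fun x hx => ?_⟩
  · rw [Finset.card_map]
    refine (Finset.card_le_card_of_injOn (t := Finset.univ) (fun x => (f x).2)
      (fun _ _ => by simp) ?_).trans_eq (Finset.card_fin t)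
    intro x hx y hy hxy
    have hx' := (Finset.mem_filter.1 hx).2
    have hy' := (Finset.mem_filter.1 hy).2
    exact hf (Prod.ext (hx'.trans hy'.symm) hxy)
  · obtain ⟨y, hy, rfl⟩ := Finset.mem_map.1 hx
    have hyj := (Finset.mem_filter.1 hy).2
    exact ⟨y.2, hyj ▸ (Finset.mem_product.1 (hfN y)).1⟩
  · refine ⟨(f ⟨x, hx⟩).1, (Finset.mem_product.1 (hfN ⟨x, hx⟩)).1, ?_⟩
    exact Finset.mem_map.2 ⟨⟨x, hx⟩, by simp, rfl⟩

/-- Counting total storage file by file. -/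
theorem sum_card_eq_sum_card_filter_mem {ι α : Type*} [Fintype ι] [Fintype α] [DecidableEq α]
    (S : ι → Finset α) :
    ∑ i, (S i).card = ∑ x, (Finset.univ.filter fun i => x ∈ S i).card := by
  have h := Finset.sum_card_bipartiteAbove_eq_sum_card_bipartiteBelow
    (s := Finset.univ) (t := Finset.univ) fun (i : ι) (x : α) => x ∈ S i
  simpa [Finset.bipartiteAbove, Finset.bipartiteBelow] using h

/-- In a consecutive ECBC every file is stored on more than `r` servers. -/
theorem isConsecutiveECBC.lt_card_filter_mem {n m k t r : ℕ} {S : Fin m → Finset (Fin n)}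
    (hS : isConsecutiveECBC n m k t r S) (hk : 1 ≤ k) (x : Fin n) :
    r < (Finset.univ.filter fun i => x ∈ S i).card := by
  by_contra! hle
  obtain ⟨C, hC, hun⟩ := hS x x le_rfl (by simpa using hk)
    (Finset.univ.filter fun i => x ∈ S i)ᶜ (by rw [Finset.card_compl, Fintype.card_fin]; omega)
  have hx : x ∈ Finset.Icc x x := by simp
  rw [← hun] at hx
  obtain ⟨j, hj, hxj⟩ := Finset.mem_biUnion.1 hx
  exact Finset.mem_compl.1 hj (by simpa using (hC j hj).1 hxj)

/-- The system storing file `x` on the `r + 1` cyclically consecutive servers from `x` on. -/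
def cyclicSystem (n m r : ℕ) (j : Fin m) : Finset (Fin n) :=
  Finset.univ.filter fun x => (j : ℕ) ∈ cyclicThickening m r {(x : ℕ)}

theorem mem_cyclicSystem {n m r : ℕ} {j : Fin m} {x : Fin n} :
    x ∈ cyclicSystem n m r j ↔ ∃ i ≤ r, ((x : ℕ) + i) % m = j := by
  simp [cyclicSystem, mem_cyclicThickening]

theorem card_filter_mem_cyclicSystem {n m r : ℕ} (hr : r < m) (x : Fin n) :
    (Finset.univ.filter fun j => x ∈ cyclicSystem n m r j).card = r + 1 := by
  have hm : 0 < m := by omega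
  have hmap : (Finset.univ.filter fun j => x ∈ cyclicSystem n m r j).map Fin.valEmbedding =
      cyclicThickening m r {(x : ℕ)} := by
    ext z
    simp only [Finset.mem_map, Finset.mem_filter, Finset.mem_univ, true_and, cyclicSystem]
    constructor
    · rintro ⟨j, hj, rfl⟩
      exact hj
    · intro hz
      exact ⟨⟨z, Finset.mem_range.1 (cyclicThickening_subset_range hm r _ hz)⟩, hz, rfl⟩
  rw [← Finset.card_map Fin.valEmbedding, hmap]
  apply le_antisymm
  · exact Finset.card_image_le.trans (by simp)
  · have h := min_le_card_cyclicThickening hm r (Finset.singleton_nonempty (x : ℕ))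
    simp only [Finset.image_singleton, Finset.card_singleton] at h
    omega

theorem isConsecutiveECBC_cyclicSystem {n m k t r : ℕ} (hr : r < m) (hk : k ≤ t * (m - r)) :
    isConsecutiveECBC n m k t r (cyclicSystem n m r) := by
  intro a b hab hlen J hJ
  have hm : 0 < m := by omega
  obtain ⟨C, hcard, hsub, hcov⟩ := exists_cover_of_card_le_mul_card_biUnion (Finset.Icc a b)
    (fun x => J.filter fun j => x ∈ cyclicSystem n m r j) t fun Y hY => by
      rcases Y.eq_empty_or_nonempty with rfl | hne
      · simp
      set N := Y.biUnion fun x => J.filter fun j => x ∈ cyclicSystem n m r j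
      set Y' := Y.map Fin.valEmbedding
      have hthick : cyclicThickening m r Y' ⊆ (N ∪ Jᶜ).map Fin.valEmbedding := by
        intro z hz
        have hzm := Finset.mem_range.1 (cyclicThickening_subset_range hm r _ hz)
        obtain ⟨x', hx', i, hi, hxi⟩ := mem_cyclicThickening.1 hz
        obtain ⟨x, hx, rfl⟩ := Finset.mem_map.1 hx'
        refine Finset.mem_map.2 ⟨⟨z, hzm⟩, Finset.mem_union.2 ?_, rfl⟩
        by_cases hzJ : (⟨z, hzm⟩ : Fin m) ∈ J
        · exact Or.inl (Finset.mem_biUnion.2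
            ⟨x, hx, Finset.mem_filter.2 ⟨hzJ, mem_cyclicSystem.2 ⟨i, hi, hxi⟩⟩⟩)
        · exact Or.inr (Finset.mem_compl.2 hzJ)
      have hgrow := min_le_card_cyclicThickening hm r (Y := Y') hne.map
      have hle := Finset.card_le_card hthick
      rw [Finset.card_map] at hle
      have hunion := Finset.card_union_le N Jᶜ
      rw [Finset.card_compl, Fintype.card_fin] at hunion
      have hYk : Y.card ≤ k := by
        refine (Finset.card_le_card hY).trans ?_
        rw [Fin.card_Icc]
        have : (a : ℕ) ≤ b := hab
        omega
      have hYres : Y.card ≤ t * (Y'.image (· % m)).card := by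
        rw [← Finset.card_map Fin.valEmbedding]
        refine card_le_mul_card_image_mod (a := a) fun x' hx' => ?_
        obtain ⟨x, hx, rfl⟩ := Finset.mem_map.1 hx'
        have hxab := Finset.mem_Icc.1 (hY hx)
        have hax : (a : ℕ) ≤ x := hxab.1
        have hxb : (x : ℕ) ≤ b := hxab.2
        have hmul : t * (m - r) ≤ t * m := Nat.mul_le_mul_left t (Nat.sub_le m r)
        simp only [Fin.valEmbedding_apply]
        omega
      rcases le_total m ((Y'.image (· % m)).card + r) with h | h
      · exact (hYk.trans hk).trans (Nat.mul_le_mul_left t (by omega))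
      · exact hYres.trans (Nat.mul_le_mul_left t (by omega))
  refine ⟨C, fun j _ => ⟨fun x hx => (Finset.mem_filter.1 (hsub j x hx).2).2, hcard j⟩, ?_⟩
  ext x
  rw [Finset.mem_biUnion]
  constructor
  · rintro ⟨j, -, hx⟩
    exact (hsub j x hx).1
  · intro hx
    obtain ⟨j, hj, hxj⟩ := hcov x hx
    exact ⟨j, (Finset.mem_filter.1 hj).1, hxj⟩

/-- If `n ≥ k` and `m ≥ ⌈k/t⌉ + r`, the minimum total storage over all consecutive
`ECBC(n,m,k,t,r)` systems equals `(r+1)·n`. -/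
theorem consecutive_ecbc_min_storage (n m k t r : ℕ)
    (hn : 1 ≤ n) (hm' : 1 ≤ m) (hk : 1 ≤ k) (ht : 1 ≤ t) (hkn : k ≤ n)
    (hm : (k + t - 1) / t + r ≤ m) :
    (∃ S : Fin m → Finset (Fin n), isConsecutiveECBC n m k t r S ∧
        ∑ i, (S i).card = (r + 1) * n) ∧
    (∀ S : Fin m → Finset (Fin n), isConsecutiveECBC n m k t r S →
        (r + 1) * n ≤ ∑ i, (S i).card) := by
  have hceil : k ≤ t * ((k + t - 1) / t) := by
    have hmod := Nat.div_add_mod (k + t - 1) t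
    have hlt := Nat.mod_lt (k + t - 1) ht
    omega
  have hpos : 0 < (k + t - 1) / t := Nat.div_pos (by omega) ht
  refine ⟨⟨cyclicSystem n m r, isConsecutiveECBC_cyclicSystem (by omega)
    (hceil.trans (Nat.mul_le_mul_left t (by omega))), ?_⟩, fun S hS => ?_⟩
  · rw [sum_card_eq_sum_card_filter_mem,
      Finset.sum_congr rfl fun x _ => card_filter_mem_cyclicSystem (by omega) x]
    simp [mul_comm]
  · rw [sum_card_eq_sum_card_filter_mem]
    calc (r + 1) * n = ∑ _x : Fin n, (r + 1) := by simp [mul_comm]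
      _ ≤ _ := Finset.sum_le_sum fun x _ => hS.lt_card_filter_mem hk x
end
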